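/- Let n ≥ 3 and let p be a real number with 1 ≤ p < n/(n−2). If f : ℝⁿ → ℝ is measurable with finite weak L^p quasinorm, i.e. sup_{λ>0} λ · |{x ∈ ℝⁿ : |f(x)| > λ}|^{1/p} < ∞, and Mf = f almost everywhere, then f = 0 almost everywhere. -/

import Mathlib

open MeasureTheory Metric ENNReal

/-- The centered Hardy–Littlewood maximal operator on `ℝⁿ`, with values in `ℝ≥0∞`. -/
noncomputable def centeredMaximal {n : ℕ} (f : EuclideanSpace ℝ (Fin n) → ℝ)
    (x : EuclideanSpace ℝ (Fin n)) : ℝ≥0∞ :=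
  ⨆ (r : ℝ) (_ : 0 < r),
    (∫⁻ y in ball x r, ENNReal.ofReal |f y| ∂volume) / volume (ball x r)

theorem eventually_quadratic_le_one_add_rpow {β κ : ℝ} (hκ : 2 * κ < β * (β + 1)) :
    ∀ᶠ t in nhds (0 : ℝ), 1 - β * t + κ * t ^ 2 ≤ (1 + t) ^ (-β) := by
  set φ : ℝ → ℝ := fun t => (1 + t) ^ (-β) - (1 - β * t + κ * t ^ 2) with hφ
  have hd (γ : ℝ) {t : ℝ} (ht : -1 < t) :
      HasDerivAt (fun t : ℝ => (1 + t) ^ γ) (γ * (1 + t) ^ (γ - 1)) t := by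
    have := ((hasDerivAt_id t).const_add 1).rpow_const (p := γ) (Or.inl (by simp; linarith))
    simpa using this
  have hq (t : ℝ) : HasDerivAt (fun t : ℝ => 1 - β * t + κ * t ^ 2) (-β + 2 * κ * t) t := by
    have := (((hasDerivAt_id t).const_mul β).const_sub 1).add
      (((hasDerivAt_id t).pow 2).const_mul κ)
    refine this.congr_deriv ?_
    simp; ring
  have h1 {t : ℝ} (ht : -1 < t) :
      HasDerivAt φ (-β * (1 + t) ^ (-β - 1) - (-β + 2 * κ * t)) t := (hd _ ht).sub (hq t)
  have h2 : deriv φ =ᶠ[nhds 0] fun t => -β * (1 + t) ^ (-β - 1) - (-β + 2 * κ * t) := by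
    filter_upwards [Ioi_mem_nhds (show (-1 : ℝ) < 0 by norm_num)] with t ht using (h1 ht).deriv
  have h3 : HasDerivAt (fun t => -β * (1 + t) ^ (-β - 1) - (-β + 2 * κ * t))
      (β * (β + 1) - 2 * κ) 0 := by
    have := ((hd (-β - 1) (t := 0) (by norm_num)).const_mul (-β)).sub
      (((hasDerivAt_id (0 : ℝ)).const_mul (2 * κ)).const_add (-β))
    refine this.congr_deriv ?_
    simp; ring
  have hmin : IsLocalMin φ 0 := by
    apply isLocalMin_of_deriv_deriv_pos
    · rw [h2.deriv_eq, h3.deriv]; linarith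
    · rw [h2.eq_of_nhds]; simp
    · exact (h1 (by norm_num)).continuousAt
  filter_upwards [hmin] with t ht
  simp [hφ] at ht ⊢
  linarith

section
variable {E : Type*} [NormedAddCommGroup E] [InnerProductSpace ℝ E] [FiniteDimensional ℝ E]
  [MeasurableSpace E] [BorelSpace E]

theorem integrableOn_ball_of_continuous {g : E → ℝ} (hg : Continuous g) (x : E) (r : ℝ) :
    IntegrableOn g (ball x r) :=
  (hg.continuousOn.integrableOn_compact (isCompact_closedBall x r)).mono_set ball_subset_closedBall

theorem setIntegral_ball_inner_sq_eq {u v : E} (h : ‖u‖ = ‖v‖) (r : ℝ) :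
    ∫ y in ball (0 : E) r, inner ℝ u y ^ 2 = ∫ y in ball (0 : E) r, inner ℝ v y ^ 2 := by
  set L := (ℝ ∙ (u - v))ᗮ.reflection with hL
  have hLu : L u = v := Submodule.reflection_sub h
  have h1 := (L.measurePreserving).setIntegral_preimage_emb
    L.toHomeomorph.measurableEmbedding (fun y => inner ℝ v y ^ 2) (ball 0 r)
  rw [← h1, LinearIsometryEquiv.preimage_ball, map_zero]
  refine integral_congr_ae (ae_of_all _ fun y => ?_)
  simp only
  rw [← hLu, L.inner_map_map]

theorem finrank_mul_setIntegral_ball_inner_sq (u : E) (r : ℝ) :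
    (Module.finrank ℝ E : ℝ) * ∫ y in ball (0 : E) r, inner ℝ u y ^ 2
      = ‖u‖ ^ 2 * ∫ y in ball (0 : E) r, ‖y‖ ^ 2 := by
  set b := stdOrthonormalBasis ℝ E
  have h1 (i) : ∫ y in ball (0 : E) r, inner ℝ u y ^ 2
      = ‖u‖ ^ 2 * ∫ y in ball (0 : E) r, inner ℝ (b i) y ^ 2 := by
    rw [setIntegral_ball_inner_sq_eq (v := ‖u‖ • b i) (by simp [norm_smul]), ← integral_const_mul]
    simp only [inner_smul_left, mul_pow, RCLike.conj_to_real]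
  have h2 : ∑ i, ∫ y in ball (0 : E) r, inner ℝ (b i) y ^ 2 = ∫ y in ball (0 : E) r, ‖y‖ ^ 2 := by
    rw [← integral_finsetSum]
    · refine integral_congr_ae (ae_of_all _ fun y => ?_)
      have := b.sum_sq_norm_inner_right y
      simpa using this
    · exact fun i _ => integrableOn_ball_of_continuous (by fun_prop) _ _
  rw [← h2, Finset.mul_sum, ← Finset.sum_congr rfl (fun i _ => h1 i)]
  simp

theorem setIntegral_ball_eq_zero_of_odd {g : E → ℝ} (hg : ∀ y, g (-y) = -g y) (r : ℝ) :
    ∫ y in ball (0 : E) r, g y = 0 := by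
  have h1 := (LinearIsometryEquiv.neg ℝ (E := E)).measurePreserving.setIntegral_preimage_emb
    (LinearIsometryEquiv.neg ℝ (E := E)).toHomeomorph.measurableEmbedding g (ball 0 r)
  rw [LinearIsometryEquiv.preimage_ball] at h1
  simp only [map_zero, LinearIsometryEquiv.coe_neg, hg, integral_neg] at h1
  linarith

theorem setIntegral_ball_norm_sq_pos [Nontrivial E] {r : ℝ} (hr : 0 < r) :
    0 < ∫ y in ball (0 : E) r, ‖y‖ ^ 2 := by
  rw [setIntegral_pos_iff_support_of_nonneg_ae (ae_of_all _ fun y => by positivity)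
    (integrableOn_ball_of_continuous (by fun_prop) _ _)]
  have : Function.support (fun y : E => ‖y‖ ^ 2) = {0}ᶜ := by ext; simp
  rw [this, Set.inter_comm, ← Set.sdiff_eq, measure_sdiff_null (measure_singleton _)]
  exact measure_ball_pos _ _ hr

theorem setIntegral_ball_quadratic_pos [Nontrivial E] {x : E} (hx : x ≠ 0) {r β κ : ℝ} (hr : 0 < r)
    (hκ : Module.finrank ℝ E * β < 4 * κ) :
    0 < ∫ y in ball (0 : E) r, (-β * ((2 * inner ℝ x y + ‖y‖ ^ 2) / ‖x‖ ^ 2)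
        + κ * ((4 * inner ℝ x y ^ 2 + 4 * (inner ℝ x y * ‖y‖ ^ 2)) / ‖x‖ ^ 4)) := by
  have hJ := setIntegral_ball_norm_sq_pos (E := E) hr
  have hQ := finrank_mul_setIntegral_ball_inner_sq x r
  have ho1 : ∫ y in ball (0 : E) r, inner ℝ x y = 0 :=
    setIntegral_ball_eq_zero_of_odd (by simp) r
  have ho2 : ∫ y in ball (0 : E) r, inner ℝ x y * ‖y‖ ^ 2 = 0 :=
    setIntegral_ball_eq_zero_of_odd (by simp) r
  have hd : (0 : ℝ) < Module.finrank ℝ E := by exact_mod_cast Module.finrank_pos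
  have hs : 0 < ‖x‖ := norm_pos_iff.2 hx
  rw [integral_add, integral_const_mul, integral_const_mul, integral_div, integral_div,
    integral_add, integral_add, integral_const_mul, integral_const_mul, integral_const_mul,
    ho1, ho2]
  rotate_left
  iterate 6 exact integrableOn_ball_of_continuous (by fun_prop) _ _
  set J := ∫ y in ball (0 : E) r, ‖y‖ ^ 2
  set Q := ∫ y in ball (0 : E) r, inner ℝ x y ^ 2
  have hQ' : Q = ‖x‖ ^ 2 * J / Module.finrank ℝ E := by field_simp; linarith
  have : -β * ((2 * 0 + J) / ‖x‖ ^ 2) + κ * ((4 * Q + 4 * 0) / ‖x‖ ^ 4)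
      = J / (‖x‖ ^ 2 * Module.finrank ℝ E) * (4 * κ - Module.finrank ℝ E * β) := by
    rw [hQ']; field_simp; ring
  rw [this]
  have : 0 < 4 * κ - Module.finrank ℝ E * β := by linarith
  positivity

theorem not_isLocalMin_sub_norm_rpow [Nontrivial E] {G : E → ℝ} (hG : Continuous G)
    (hsup : ∀ x r, 0 < r → ∫ y in ball (0 : E) r, (G (x + y) - G x) ≤ 0) {α m : ℝ} (hα : 0 < α)
    (hαd : (Module.finrank ℝ E : ℝ) - 2 < α) (hm : 0 < m) {x : E} (hx : x ≠ 0) :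
    ¬ IsLocalMin (fun y => G y - m * ‖y‖ ^ (-α)) x := by
  intro hmin
  set d : ℝ := ((Module.finrank ℝ E : ℕ) : ℝ) with hd
  have hd0 : 0 < d := by rw [hd]; exact_mod_cast Module.finrank_pos
  set β := α / 2 with hβ
  have hβ0 : 0 < β := by positivity
  obtain ⟨κ, hκ1, hκ2⟩ : ∃ κ, d * β / 4 < κ ∧ κ < β * (β + 1) / 2 :=
    exists_between (by nlinarith)
  have hκ0 : 0 ≤ κ := (by positivity : 0 ≤ d * β / 4).trans hκ1.le
  have hs : 0 < ‖x‖ := norm_pos_iff.2 hx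
  have htt : Filter.Tendsto (fun y : E => (2 * inner ℝ x y + ‖y‖ ^ 2) / ‖x‖ ^ 2)
      (nhds 0) (nhds 0) := by
    have : Continuous (fun y : E => (2 * inner ℝ x y + ‖y‖ ^ 2) / ‖x‖ ^ 2) := by fun_prop
    simpa using this.tendsto 0
  have hev1 := htt.eventually (eventually_quadratic_le_one_add_rpow (β := β) (κ := κ) (by linarith))
  have hxt : Filter.Tendsto (fun y : E => x + y) (nhds 0) (nhds x) := by
    have : Continuous (fun y : E => x + y) := by fun_prop
    simpa using this.tendsto 0
  obtain ⟨r, hr, hball⟩ := Metric.eventually_nhds_iff_ball.1 (hev1.and (hxt.eventually hmin))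
  set q : E → ℝ := fun y => -β * ((2 * inner ℝ x y + ‖y‖ ^ 2) / ‖x‖ ^ 2)
        + κ * ((4 * inner ℝ x y ^ 2 + 4 * (inner ℝ x y * ‖y‖ ^ 2)) / ‖x‖ ^ 4) with hq
  have hpos : 0 < ∫ y in ball (0 : E) r, m * ‖x‖ ^ (-α) * q y := by
    rw [integral_const_mul]
    have := setIntegral_ball_quadratic_pos hx hr (β := β) (κ := κ) (by linarith)
    positivity
  have hle : ∫ y in ball (0 : E) r, m * ‖x‖ ^ (-α) * q y
      ≤ ∫ y in ball (0 : E) r, (G (x + y) - G x) := by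
    refine setIntegral_mono_on (integrableOn_ball_of_continuous (by fun_prop) _ _)
      (integrableOn_ball_of_continuous (by fun_prop) _ _) measurableSet_ball fun y hy => ?_
    obtain ⟨h1, h2⟩ := hball y hy
    set t := (2 * inner ℝ x y + ‖y‖ ^ 2) / ‖x‖ ^ 2 with ht
    have hxy : ‖x + y‖ ^ 2 = ‖x‖ ^ 2 * (1 + t) := by
      rw [norm_add_sq_real, ht]; field_simp; ring
    have ht0 : 0 ≤ 1 + t := by
      have : 1 + t = ‖x + y‖ ^ 2 / ‖x‖ ^ 2 := by rw [hxy]; field_simp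
      rw [this]; positivity
    have hpow (z : E) : ‖z‖ ^ (-α) = (‖z‖ ^ 2) ^ (-β) := by
      rw [← Real.rpow_natCast, ← Real.rpow_mul (norm_nonneg _)]
      congr 1; rw [hβ]; push_cast; ring
    have h3 : ‖x + y‖ ^ (-α) = ‖x‖ ^ (-α) * (1 + t) ^ (-β) := by
      rw [hpow, hpow, hxy, Real.mul_rpow (by positivity) ht0]
    have h4 : q y ≤ -β * t + κ * t ^ 2 := by
      have : -β * t + κ * t ^ 2 - q y = κ * (‖y‖ ^ 4 / ‖x‖ ^ 4) := by
        simp only [hq, ht]; field_simp; ring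
      have : 0 ≤ κ * (‖y‖ ^ 4 / ‖x‖ ^ 4) := by positivity
      linarith
    have h5 : q y ≤ (1 + t) ^ (-β) - 1 := by linarith
    have h6 : m * ‖x‖ ^ (-α) * q y ≤ m * ‖x‖ ^ (-α) * ((1 + t) ^ (-β) - 1) := by gcongr
    beta_reduce at h2
    rw [h3] at h2
    linarith
  linarith [hsup x r hr]

theorem exists_mul_norm_rpow_le [Nontrivial E] {G : E → ℝ} (hG : Continuous G)
    (hpos : ∀ x, 0 < G x)
    (hsup : ∀ x r, 0 < r → ∫ y in ball (0 : E) r, (G (x + y) - G x) ≤ 0) {α : ℝ} (hα : 0 < α)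
    (hαd : (Module.finrank ℝ E : ℝ) - 2 < α) :
    ∃ m > 0, ∀ x, 1 ≤ ‖x‖ → m * ‖x‖ ^ (-α) ≤ G x := by
  obtain ⟨z, -, hz⟩ := (isCompact_closedBall (0 : E) 1).exists_isMinOn ⟨0, by simp⟩ hG.continuousOn
  refine ⟨G z, hpos z, fun x hx => ?_⟩
  by_contra! hlt
  set m := G z
  have hm : 0 < m := hpos z
  set w : E → ℝ := fun y => G y - m * ‖y‖ ^ (-α) with hw
  have hwx : w x < 0 := by simp only [hw]; linarith
  have hdecay : Filter.Tendsto (fun R : ℝ => -(m * R ^ (-α))) Filter.atTop (nhds 0) := by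
    simpa using ((tendsto_rpow_neg_atTop hα).const_mul m).neg
  obtain ⟨R, hR, hxR⟩ := ((hdecay.eventually (lt_mem_nhds hwx)).and
    (Filter.eventually_gt_atTop ‖x‖)).exists
  set K : Set E := closedBall 0 R ∩ {y | 1 ≤ ‖y‖} with hK
  have hKc : IsCompact K :=
    (isCompact_closedBall 0 R).inter_right (isClosed_le continuous_const continuous_norm)
  have hwc : ContinuousOn w K := by
    refine hG.continuousOn.sub (continuousOn_const.mul ?_)
    refine continuous_norm.continuousOn.rpow_const fun y hy => Or.inl ?_
    have : 1 ≤ ‖y‖ := hy.2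
    linarith
  have hxK : x ∈ K := ⟨by simpa using hxR.le, hx⟩
  obtain ⟨y, hyK, hy⟩ := hKc.exists_isMinOn ⟨x, hxK⟩ hwc
  have hwy : w y ≤ w x := hy hxK
  have hy1 : 1 ≤ ‖y‖ := hyK.2
  have hyR : ‖y‖ ≤ R := by simpa using hyK.1
  have hy1' : 1 < ‖y‖ := by
    refine lt_of_le_of_ne hy1 fun h => ?_
    have h1 : m ≤ G y := hz (show y ∈ closedBall 0 1 by simp [← h])
    have h2 : w y = G y - m := by simp [hw, ← h]
    linarith
  have hyR' : ‖y‖ < R := by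
    refine lt_of_le_of_ne hyR fun h => ?_
    have h2 : w y = G y - m * R ^ (-α) := by simp [hw, ← h]
    linarith [hpos y]
  have hy0 : y ≠ 0 := norm_pos_iff.1 (by linarith)
  refine not_isLocalMin_sub_norm_rpow hG hsup hα hαd hm hy0 (hy.isLocalMin ?_)
  refine Filter.inter_mem (closedBall_mem_nhds_of_mem (by simpa using hyR')) ?_
  filter_upwards [(isOpen_lt continuous_const continuous_norm).mem_nhds hy1'] with v hv using hv.le

theorem setLIntegral_ball_eq_add_left (F : E → ℝ≥0∞) (x : E) (r : ℝ) :
    ∫⁻ y in ball x r, F y = ∫⁻ y in ball (0 : E) r, F (x + y) := by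
  have h := (measurePreserving_add_left volume x).setLIntegral_comp_preimage_emb
    (Homeomorph.addLeft x).measurableEmbedding F (ball x r)
  rw [← h]
  congr 2
  ext y
  simp

theorem lintegral_ball_ne_top [Nontrivial E] {F : E → ℝ≥0∞} (hfin : ∀ᵐ x, F x ≠ ⊤)
    (hF : ∀ᵐ x, ∀ r, 0 < r → ∫⁻ y in ball x r, F y ≤ F x * volume (ball x r)) (x : E) (r : ℝ) :
    ∫⁻ y in ball x r, F y ≠ ⊤ := by
  obtain ⟨z, hz1, hz2⟩ := (hfin.and hF).exists
  have hR : 0 < |r| + dist x z + 1 := by positivity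
  refine ne_top_of_le_ne_top (ENNReal.mul_ne_top hz1 measure_ball_lt_top.ne)
    ((lintegral_mono_set (ball_subset_ball' ?_)).trans (hz2 _ hR))
  linarith [le_abs_self r]

theorem lintegral_ball_ne_zero {F : E → ℝ≥0∞} (hFm : Measurable F)
    (hF : ∀ᵐ x, ∀ r, 0 < r → ∫⁻ y in ball x r, F y ≤ F x * volume (ball x r))
    (hne : ¬ F =ᵐ[volume] 0) (x : E) {r : ℝ} (hr : 0 < r) :
    ∫⁻ y in ball x r, F y ≠ 0 := by
  intro h0
  apply hne
  rw [lintegral_eq_zero_iff hFm, Filter.EventuallyEq, ae_restrict_iff' measurableSet_ball] at h0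
  obtain ⟨z, hz, hz0, hzF⟩ : ∃ z ∈ ball x r, F z = 0 ∧
      ∀ r, 0 < r → ∫⁻ y in ball z r, F y ≤ F z * volume (ball z r) := by
    by_contra! hcon
    refine (measure_ball_pos volume x hr).ne' (measure_mono_null (fun z hz => ?_)
      (show volume {z | ¬ ((z ∈ ball x r → F z = 0) ∧ ∀ r, 0 < r →
        ∫⁻ y in ball z r, F y ≤ F z * volume (ball z r))} = 0 from h0.and hF))
    rintro ⟨h1, h2⟩
    obtain ⟨r', hr', hlt⟩ := hcon z hz (h1 hz)
    exact hlt.not_ge (h2 r' hr')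
  have h1 (k : ℕ) : ∀ᵐ y, y ∈ ball z (k + 1 : ℝ) → F y = 0 := by
    have h2 := hzF (k + 1) (by positivity)
    rw [hz0, zero_mul, nonpos_iff_eq_zero, lintegral_eq_zero_iff hFm, Filter.EventuallyEq,
      ae_restrict_iff' measurableSet_ball] at h2
    exact h2
  filter_upwards [ae_all_iff.2 h1] with y hy
  obtain ⟨k, hk⟩ := exists_nat_gt (dist y z)
  exact hy k (mem_ball.2 (by linarith))

theorem lintegral_ball_lintegral_ball_le {F : E → ℝ≥0∞} (hFm : Measurable F)
    (hF : ∀ᵐ x, ∀ r, 0 < r → ∫⁻ y in ball x r, F y ≤ F x * volume (ball x r)) (x : E)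
    {r s : ℝ} (hr : 0 < r) :
    ∫⁻ y in ball (0 : E) r, ∫⁻ u in ball (x + y) s, F u
      ≤ (∫⁻ u in ball x s, F u) * volume (ball (0 : E) r) := by
  simp only [setLIntegral_ball_eq_add_left F]
  rw [lintegral_lintegral_swap (by fun_prop), ← lintegral_mul_const _ (by fun_prop)]
  refine lintegral_mono_ae (ae_restrict_of_ae ?_)
  filter_upwards [(measurePreserving_add_left volume x).quasiMeasurePreserving.ae hF] with u hu
  have := hu r hr
  rw [setLIntegral_ball_eq_add_left, Measure.addHaar_ball_center] at this
  simpa only [add_right_comm] using this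

theorem continuous_setIntegral_ball [Nontrivial E] {F : E → ℝ}
    (hF : ∀ x r, IntegrableOn F (ball x r)) {s : ℝ} :
    Continuous fun x => ∫ y in ball x s, F y := by
  simp_rw [← integral_indicator measurableSet_ball]
  refine continuous_iff_continuousAt.2 fun x => ?_
  refine continuousAt_of_dominated (bound := (ball x (s + 1)).indicator fun y => ‖F y‖)
    (Filter.Eventually.of_forall fun z =>
      ((hF z s).integrable_indicator measurableSet_ball).aestronglyMeasurable) ?_
    (IntegrableOn.integrable_indicator (hF x (s + 1)).norm measurableSet_ball) ?_
  · filter_upwards [ball_mem_nhds x one_pos] with z hz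
    refine ae_of_all _ fun y => ?_
    rw [norm_indicator_eq_indicator_norm]
    refine Set.indicator_le_indicator_of_subset (ball_subset_ball' ?_) (fun _ => norm_nonneg _) y
    linarith [mem_ball.1 hz]
  · have h0 : ∀ᵐ y, y ∉ sphere x s :=
      measure_eq_zero_iff_ae_notMem.1 (Measure.addHaar_sphere volume x s)
    filter_upwards [h0] with y hy
    have hd : Continuous fun z => dist y z := by fun_prop
    rcases lt_or_gt_of_ne (show dist y x ≠ s from hy) with h | h
    · refine (continuousAt_const (y := F y)).congr ?_
      filter_upwards [hd.continuousAt.eventually (gt_mem_nhds h)] with z hz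
      exact (Set.indicator_of_mem (mem_ball.2 hz) _).symm
    · refine (continuousAt_const (y := 0)).congr ?_
      filter_upwards [hd.continuousAt.eventually (lt_mem_nhds h)] with z hz
      exact (Set.indicator_of_notMem (fun h' => (mem_ball.1 h').not_gt hz) _).symm

theorem exists_ofReal_mul_norm_rpow_le [Nontrivial E] {F : E → ℝ≥0∞} (hFm : Measurable F)
    (hfin : ∀ᵐ x, F x ≠ ⊤)
    (hF : ∀ᵐ x, ∀ r, 0 < r → ∫⁻ y in ball x r, F y ≤ F x * volume (ball x r))
    (hne : ¬ F =ᵐ[volume] 0) {α : ℝ} (hα : 0 < α) (hαd : (Module.finrank ℝ E : ℝ) - 2 < α) :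
    ∃ c > 0, ∀ᵐ x : E, 1 ≤ ‖x‖ → ENNReal.ofReal (c * ‖x‖ ^ (-α)) ≤ F x := by
  have htop := lintegral_ball_ne_top hfin hF
  set G : E → ℝ := fun x => (∫⁻ y in ball x 1, F y).toReal with hG
  have hGc : Continuous G := by
    have h1 (x : E) (r : ℝ) : IntegrableOn (fun y => (F y).toReal) (ball x r) :=
      integrable_toReal_of_lintegral_ne_top hFm.aemeasurable (htop x r)
    have h2 : G = fun x => ∫ y in ball x 1, (F y).toReal := by
      funext x
      exact (integral_toReal hFm.aemeasurable
        (ae_restrict_of_ae (hfin.mono fun y => lt_top_iff_ne_top.2))).symm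
    rw [h2]
    exact continuous_setIntegral_ball h1
  have hGpos (x : E) : 0 < G x :=
    ENNReal.toReal_pos (lintegral_ball_ne_zero hFm hF hne x one_pos) (htop x 1)
  have hGsup (x : E) (r : ℝ) (hr : 0 < r) : ∫ y in ball (0 : E) r, (G (x + y) - G x) ≤ 0 := by
    have hle := ENNReal.toReal_mono (ENNReal.mul_ne_top (htop x 1) measure_ball_lt_top.ne)
      (lintegral_ball_lintegral_ball_le hFm hF x (s := 1) hr)
    have hGm : Measurable fun y => ∫⁻ u in ball (x + y) 1, F u := by
      have h : (fun y => ∫⁻ u in ball (x + y) 1, F u) = fun y => ENNReal.ofReal (G (x + y)) := by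
        funext y
        exact (ENNReal.ofReal_toReal (htop _ _)).symm
      rw [h]
      exact (hGc.comp (continuous_const.add continuous_id)).measurable.ennreal_ofReal
    rw [integral_sub (integrableOn_ball_of_continuous (by fun_prop) _ _)
      (integrableOn_ball_of_continuous (by fun_prop) _ _), setIntegral_const, sub_nonpos]
    have h : ∫ y in ball (0 : E) r, G (x + y)
        = (∫⁻ y in ball (0 : E) r, ∫⁻ u in ball (x + y) 1, F u).toReal :=
      integral_toReal hGm.aemeasurable (ae_of_all _ fun y => lt_top_iff_ne_top.2 (htop _ _))
    rw [h, smul_eq_mul, mul_comm]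
    rwa [ENNReal.toReal_mul] at hle
  obtain ⟨m, hm, hmG⟩ := exists_mul_norm_rpow_le hGc hGpos hGsup hα hαd
  set V := volume (ball (0 : E) 1) with hV
  have hV0 : V ≠ 0 := (measure_ball_pos _ _ one_pos).ne'
  have hVt : V ≠ ⊤ := measure_ball_lt_top.ne
  refine ⟨m / V.toReal, div_pos hm (ENNReal.toReal_pos hV0 hVt), ?_⟩
  filter_upwards [hF] with x hx hx1
  have h1 := hx 1 one_pos
  rw [Measure.addHaar_ball_center, ← hV, ← ENNReal.div_le_iff hV0 hVt] at h1
  refine le_trans ?_ h1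
  rw [div_mul_eq_mul_div, ENNReal.ofReal_div_of_pos (ENNReal.toReal_pos hV0 hVt),
    ENNReal.ofReal_toReal hVt]
  gcongr
  exact (ENNReal.ofReal_le_ofReal (hmG x hx1)).trans_eq (ENNReal.ofReal_toReal (htop x 1))

theorem weak_quasinorm_not_le_of_norm_rpow_le [Nontrivial E] {F : E → ℝ≥0∞} {c α p : ℝ}
    (hc : 0 < c) (hα : 0 < α) (hp : 0 < p) (hαp : α < Module.finrank ℝ E / p)
    (hle : ∀ᵐ x : E, 1 ≤ ‖x‖ → ENNReal.ofReal (c * ‖x‖ ^ (-α)) ≤ F x) {C : ℝ≥0∞} (hC : C ≠ ⊤) :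
    ¬ ∀ l : ℝ, 0 < l →
      ENNReal.ofReal l * volume {x : E | ENNReal.ofReal l < F x} ^ (1 / p) ≤ C := by
  intro hweak
  set d := Module.finrank ℝ E with hd
  have hd0 : d ≠ 0 := Module.finrank_pos.ne'
  set V := volume (ball (0 : E) 1) with hV
  have hV0 : V ≠ 0 := (measure_ball_pos _ _ one_pos).ne'
  have hVt : V ≠ ⊤ := measure_ball_lt_top.ne
  have hVr : 0 < V.toReal := ENNReal.toReal_pos hV0 hVt
  have key (ρ : ℝ) (hρ : 2 ≤ ρ) :
      c * (V.toReal / 2) ^ (1 / p) * ρ ^ (d / p - α) ≤ C.toReal := by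
    have hρ0 : 0 < ρ := by linarith
    have hl : 0 < c * ρ ^ (-α) := by positivity
    have hsub : ENNReal.ofReal (ρ ^ d * (V.toReal / 2))
        ≤ volume {x : E | ENNReal.ofReal (c * ρ ^ (-α)) < F x} := by
      have h1 : volume (ball (0 : E) ρ \ ball 0 1)
          ≤ volume {x : E | ENNReal.ofReal (c * ρ ^ (-α)) < F x} := by
        refine measure_mono_ae ?_
        filter_upwards [hle] with x hx hxm
        have hx1 : 1 ≤ ‖x‖ := by simpa using hxm.2
        have hx2 : ‖x‖ < ρ := by simpa using hxm.1
        refine lt_of_lt_of_le ((ENNReal.ofReal_lt_ofReal_iff (by positivity)).2 ?_) (hx hx1)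
        exact mul_lt_mul_of_pos_left
          (Real.rpow_lt_rpow_of_neg (by positivity) hx2 (by linarith)) hc
      refine le_trans ?_ h1
      rw [measure_sdiff (ball_subset_ball (by linarith)) measurableSet_ball.nullMeasurableSet hVt,
        Measure.addHaar_ball _ _ hρ0.le, ← hV]
      conv_rhs => rw [← ENNReal.ofReal_toReal hVt]
      rw [← ENNReal.ofReal_mul (by positivity), ← ENNReal.ofReal_sub _ hVr.le]
      refine ENNReal.ofReal_le_ofReal ?_
      have h2 : 2 ≤ ρ ^ d := hρ.trans (le_self_pow₀ (by linarith) hd0)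
      nlinarith
    have h := (mul_le_mul_right (ENNReal.rpow_le_rpow hsub (by positivity : 0 ≤ 1 / p)) _).trans
      (hweak _ hl)
    rw [ENNReal.ofReal_rpow_of_nonneg (by positivity) (by positivity),
      ← ENNReal.ofReal_mul hl.le] at h
    refine le_trans (le_of_eq ?_) ((ENNReal.ofReal_le_iff_le_toReal hC).1 h)
    rw [Real.mul_rpow (by positivity) (by positivity), ← Real.rpow_natCast,
      ← Real.rpow_mul hρ0.le, sub_eq_add_neg, Real.rpow_add hρ0, mul_one_div]
    ring
  have htend := (tendsto_rpow_atTop (sub_pos.2 hαp)).const_mul_atTop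
    (show 0 < c * (V.toReal / 2) ^ (1 / p) by positivity)
  obtain ⟨ρ, h1, h2⟩ := ((htend.eventually_gt_atTop C.toReal).and
    (Filter.eventually_ge_atTop 2)).exists
  exact (key ρ h2).not_gt h1

end

theorem statement13 (n : ℕ) (hn : 3 ≤ n) (p : ℝ) (hp1 : 1 ≤ p)
    (hp2 : p < (n : ℝ) / ((n : ℝ) - 2))
    (f : EuclideanSpace ℝ (Fin n) → ℝ) (hmeas : Measurable f)
    (hweak : ∃ C : ℝ≥0∞, C ≠ ⊤ ∧ ∀ l : ℝ, 0 < l →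
      ENNReal.ofReal l *
        (volume {x : EuclideanSpace ℝ (Fin n) | l < |f x|}) ^ (1 / p) ≤ C)
    (hfix : ∀ᵐ x ∂(volume : Measure (EuclideanSpace ℝ (Fin n))),
      centeredMaximal f x = ENNReal.ofReal (f x)) :
    f =ᵐ[volume] (fun _ => (0 : ℝ)) := by
  obtain ⟨C, hC, hweak⟩ := hweak
  have hn' : (0 : ℝ) < n - 2 := by
    have : (3 : ℝ) ≤ n := by exact_mod_cast hn
    linarith
  have : NeZero n := ⟨by lia⟩
  have hp0 : 0 < p := by linarith
  set F : EuclideanSpace ℝ (Fin n) → ℝ≥0∞ := fun x => ENNReal.ofReal |f x| with hFdef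
  have hFm : Measurable F := (measurable_norm.comp hmeas).ennreal_ofReal
  have hF : ∀ᵐ x, ∀ r, 0 < r → ∫⁻ y in ball x r, F y ≤ F x * volume (ball x r) := by
    filter_upwards [hfix] with x hx r hr
    rw [← ENNReal.div_le_iff (measure_ball_pos _ _ hr).ne' measure_ball_lt_top.ne]
    refine le_trans ?_ (hx.trans_le (ENNReal.ofReal_le_ofReal (le_abs_self _)))
    exact le_iSup₂ (f := fun (r : ℝ) (_ : 0 < r) => (∫⁻ y in ball x r, F y) / volume (ball x r))
      r hr
  by_contra hne
  have hne' : ¬ F =ᵐ[volume] 0 := fun h => hne <| by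
    filter_upwards [h] with x hx
    simpa [hFdef] using hx
  obtain ⟨α, hα1, hα2⟩ : ∃ α : ℝ, (n : ℝ) - 2 < α ∧ α < n / p := by
    refine exists_between ?_
    rw [lt_div_iff₀ hn'] at hp2
    rw [lt_div_iff₀ hp0]
    linarith
  obtain ⟨c, hc, hcF⟩ := exists_ofReal_mul_norm_rpow_le hFm (ae_of_all _ fun _ => ofReal_ne_top)
    hF hne' (α := α) (by linarith) (by simpa using hα1)
  refine weak_quasinorm_not_le_of_norm_rpow_le hc (by linarith) hp0 (by simpa using hα2) hcF hC
    fun l hl => ?_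
  simpa only [hFdef, ENNReal.ofReal_lt_ofReal_iff_of_nonneg hl.le] using hweak l hl
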